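/- (Theorem 1) For every optimal conditional machine U and every polynomial P with natural-number coefficients there exists a constant c ∈ ℕ such that for every string x and all positive integers m, n satisfying n + c·log n ≤ C(x), C(x) ≤ P(n), c·log n ≤ m, and m ≤ P(n), there exists a string y with |C(x|y) − n| ≤ c and |C(y|x) − m| ≤ c (differences in ℤ). -/

import Mathlib

/-- A string is a finite binary string. -/
abbrev Str : Type := List Bool

/-- A conditional machine: a partial computable function mapping a pair of
strings `(p, y)` to a string. -/
abbrev CondMachine : Type := {V : Str × Str →. Str // Partrec V}

/-- `condC V x y` is `C_V(x|y)`: the least length of a program `p` with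
`V (p, y) = x`, as an element of `ℕ∞` (it is `⊤` if no such `p` exists). -/
noncomputable def condC (V : CondMachine) (x y : Str) : ℕ∞ :=
  sInf {n : ℕ∞ | ∃ p : Str, x ∈ V.1 (p, y) ∧ (p.length : ℕ∞) = n}

/-- A conditional machine `U` is optimal if for every conditional machine `V`
there is a constant `d` with `C_U(x|y) ≤ C_V(x|y) + d` for all `x, y`. -/
def OptimalMachine (U : CondMachine) : Prop :=
  ∀ V : CondMachine, ∃ d : ℕ, ∀ x y : Str, condC U x y ≤ condC V x y + (d : ℕ∞)

/-- For an optimal machine all complexities are finite natural numbers. -/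
noncomputable def KC (U : CondMachine) (x y : Str) : ℕ := (condC U x y).toNat

/-- `log2 n = Nat.log 2 (n + 2)`, so `log2 n ≥ 1`. -/
def log2 (n : ℕ) : ℕ := Nat.log 2 (n + 2)

/-! ### A discrete Poincaré–Miranda theorem -/

/-- The parity label of an edge whose endpoints carry the labels `(a, b)` and `(a', b')`. -/
def edgeParity (a b a' b' : Bool) : ZMod 2 :=
  if a && a' && (b ^^ b') then 1 else 0

theorem edgeParity_square : ∀ a₁ b₁ a₂ b₂ a₃ b₃ a₄ b₄ : Bool,
    ¬ ((a₁ || a₂ || a₃ || a₄) ∧ ¬ (a₁ && a₂ && a₃ && a₄) ∧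
      (b₁ || b₂ || b₃ || b₄) ∧ ¬ (b₁ && b₂ && b₃ && b₄)) →
    edgeParity a₃ b₃ a₄ b₄ = edgeParity a₁ b₁ a₂ b₂ +
      (edgeParity a₂ b₂ a₄ b₄ + edgeParity a₁ b₁ a₃ b₃) := by
  decide

theorem sum_range_add_succ_zmod_two (h : ℕ → ZMod 2) (L : ℕ) :
    ∑ l ∈ Finset.range L, (h (l + 1) + h l) = h L + h 0 := by
  have h2 : (2 : ZMod 2) = 0 := rfl
  induction L with
  | zero => simp only [Finset.range_zero, Finset.sum_empty]; linear_combination -h 0 * h2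
  | succ L ih => rw [Finset.sum_range_succ, ih]; linear_combination h L * h2

/-- If `A` holds on the left side of a grid and fails on the right side, while `B` fails on the
bottom side and holds on the top side, then some unit square meets both sets and both
complements. -/
theorem exists_mixed_square (A B : ℕ → ℕ → Bool) (N L : ℕ)
    (hleft : ∀ l ≤ L, A 0 l = true) (hright : ∀ l ≤ L, A N l = false)
    (hbot : ∀ k ≤ N, B k 0 = false) (htop : ∀ k ≤ N, B k L = true) :
    ∃ k < N, ∃ l < L,
      (A k l || A k (l + 1) || A (k + 1) l || A (k + 1) (l + 1)) ∧
      ¬ (A k l && A k (l + 1) && A (k + 1) l && A (k + 1) (l + 1)) ∧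
      (B k l || B k (l + 1) || B (k + 1) l || B (k + 1) (l + 1)) ∧
      ¬ (B k l && B k (l + 1) && B (k + 1) l && B (k + 1) (l + 1)) := by
  by_contra hcon
  let E (k l k' l' : ℕ) := edgeParity (A k l) (B k l) (A k' l') (B k' l')
  have hstep : ∀ k < N, ∑ l ∈ Finset.range L, E (k + 1) l (k + 1) (l + 1) =
      ∑ l ∈ Finset.range L, E k l k (l + 1) := by
    intro k hk
    have hsq : ∀ l ∈ Finset.range L, E (k + 1) l (k + 1) (l + 1) =
        E k l k (l + 1) + (E k (l + 1) (k + 1) (l + 1) + E k l (k + 1) l) := fun l hl =>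
      edgeParity_square _ _ _ _ _ _ _ _ fun h =>
        hcon ⟨k, hk, l, Finset.mem_range.1 hl, h⟩
    rw [Finset.sum_congr rfl hsq, Finset.sum_add_distrib,
      sum_range_add_succ_zmod_two (fun l => E k l (k + 1) l)]
    simp [E, edgeParity, hbot k hk.le, hbot (k + 1) hk, htop k hk.le, htop (k + 1) hk]
  have hconst : ∀ k ≤ N, ∑ l ∈ Finset.range L, E k l k (l + 1) =
      ∑ l ∈ Finset.range L, E 0 l 0 (l + 1) := by
    intro k
    induction k with
    | zero => intro; rfl
    | succ k ih => intro hk; rw [hstep k hk, ih (by omega)]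
  have hN : ∑ l ∈ Finset.range L, E N l N (l + 1) = 0 :=
    Finset.sum_eq_zero fun l hl => by
      simp [E, edgeParity, hright l (Finset.mem_range.1 hl).le]
  have h0 : ∑ l ∈ Finset.range L, E 0 l 0 (l + 1) = 1 := by
    have hb : ∀ l ∈ Finset.range L, E 0 l 0 (l + 1) =
        (if B 0 (l + 1) then 1 else 0) + (if B 0 l then 1 else 0) := by
      intro l hl
      have hl := Finset.mem_range.1 hl
      simp only [E, edgeParity, hleft l hl.le, hleft (l + 1) hl]
      cases B 0 l <;> cases B 0 (l + 1) <;> decide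
    rw [Finset.sum_congr rfl hb,
      sum_range_add_succ_zmod_two (fun l => if B 0 l then 1 else 0)]
    simp [hbot 0 (Nat.zero_le _), htop 0 (Nat.zero_le _)]
  exact zero_ne_one ((hN.symm.trans (hconst N le_rfl)).trans h0)

/-! ### Basic properties of complexity -/

theorem condC_le_of_mem {V : CondMachine} {p x y : Str} (h : x ∈ V.1 (p, y)) :
    condC V x y ≤ p.length :=
  sInf_le ⟨p, h, rfl⟩

theorem condC_ne_top {U : CondMachine} (hU : OptimalMachine U) (x y : Str) :
    condC U x y ≠ ⊤ := by
  obtain ⟨d, hd⟩ := hU ⟨fun a => Part.some a.1, Computable.fst⟩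
  have h := (hd x y).trans (add_le_add_left (condC_le_of_mem (p := x) (Part.mem_some x)) _)
  exact ne_top_of_le_ne_top (by exact_mod_cast ENat.natCast_ne_top (x.length + d)) h

theorem KC_le_of_mem {U : CondMachine} {p x y : Str}
    (h : x ∈ U.1 (p, y)) : KC U x y ≤ p.length :=
  ENat.toNat_le_of_le_natCast (condC_le_of_mem h)

theorem exists_program {U : CondMachine} (hU : OptimalMachine U) (x y : Str) :
    ∃ p : Str, x ∈ U.1 (p, y) ∧ p.length = KC U x y := by
  have hne : {n : ℕ∞ | ∃ p : Str, x ∈ U.1 (p, y) ∧ (p.length : ℕ∞) = n}.Nonempty := by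
    by_contra h
    rw [Set.not_nonempty_iff_eq_empty] at h
    exact condC_ne_top hU x y (by rw [condC, h, sInf_empty])
  obtain ⟨p, hp, hlen⟩ := csInf_mem hne
  refine ⟨p, hp, ?_⟩
  rw [KC, condC, ← hlen, ENat.toNat_natCast]

theorem OptimalMachine.exists_KC_le {U : CondMachine} (hU : OptimalMachine U)
    {V : Str × Str →. Str} (hV : Partrec V) :
    ∃ d : ℕ, ∀ p x y : Str, x ∈ V (p, y) → KC U x y ≤ p.length + d := by
  obtain ⟨d, hd⟩ := hU ⟨V, hV⟩
  refine ⟨d, fun p x y h => ENat.toNat_le_of_le_natCast ?_⟩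
  push_cast
  exact (hd x y).trans (add_le_add_left (condC_le_of_mem h) _)

/-- Applying a computable function to the condition cannot decrease complexity by more than a
constant, and applying it to the object cannot increase complexity by more than a constant. -/
theorem OptimalMachine.exists_KC_comp_le {U : CondMachine} (hU : OptimalMachine U)
    {h : Str → Str} (hh : Computable h) :
    ∃ d : ℕ, ∀ x y : Str, KC U x y ≤ KC U x (h y) + d ∧ KC U (h y) x ≤ KC U y x + d := by
  obtain ⟨d₁, hd₁⟩ := hU.exists_KC_le (V := fun a => U.1 (a.1, h a.2))
    (U.2.comp (Computable.fst.pair (hh.comp Computable.snd)))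
  obtain ⟨d₂, hd₂⟩ := hU.exists_KC_le (V := fun a => (U.1 a).map h)
    (U.2.map (hh.comp Computable.snd).to₂)
  refine ⟨d₁ + d₂, fun x y => ⟨?_, ?_⟩⟩
  · obtain ⟨p, hp, hlen⟩ := exists_program hU x (h y)
    have := hd₁ p x y hp
    omega
  · obtain ⟨p, hp, hlen⟩ := exists_program hU y x
    have := hd₂ p (h y) x (Part.mem_map h hp)
    omega

/-- Two strings are interchangeable up to a constant, both as condition and as object, when
each is obtained from the other by a fixed computable function. -/
theorem OptimalMachine.exists_KC_near {U : CondMachine} (hU : OptimalMachine U)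
    {h h' : Str → Str} (hh : Computable h) (hh' : Computable h') :
    ∃ d : ℕ, ∀ x y y' : Str, h y = y' → h' y' = y →
      KC U x y ≤ KC U x y' + d ∧ KC U x y' ≤ KC U x y + d ∧
      KC U y x ≤ KC U y' x + d ∧ KC U y' x ≤ KC U y x + d := by
  obtain ⟨d₁, hd₁⟩ := hU.exists_KC_comp_le hh
  obtain ⟨d₂, hd₂⟩ := hU.exists_KC_comp_le hh'
  refine ⟨d₁ + d₂, ?_⟩
  rintro x y y' rfl hy
  have h₁ := hd₁ x y
  have h₂ := hd₂ x (h y)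
  rw [hy] at h₂
  omega

/-! ### Pairing of strings -/

/-- A computable injective encoding of pairs of strings by strings. -/
def strPair (a : Str × Str) : Str := (List.range (Encodable.encode a)).map fun _ => true

/-- The left inverse of `strPair`. -/
def strUnpair (y : Str) : Str × Str := (Encodable.decode y.length).getD ([], [])

@[simp]
theorem strUnpair_strPair (a : Str × Str) : strUnpair (strPair a) = a := by
  simp [strUnpair, strPair]

theorem primrec_strPair : Primrec strPair :=
  Primrec.list_map (Primrec.list_range.comp Primrec.encode) (Primrec.const true).to₂

theorem primrec_strUnpair : Primrec strUnpair :=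
  Primrec.option_getD.comp (Primrec.decode.comp Primrec.list_length) (Primrec.const ([], []))

theorem primrec_dropLast : Primrec (List.dropLast : Str → Str) :=
  (Primrec.list_take.comp (Primrec.nat_sub.comp Primrec.list_length (Primrec.const 1))
    Primrec.id).of_eq fun l => (List.dropLast_eq_take (l := l)).symm

/-- Appending one bit to either component of a pair changes complexities by at most a
constant. -/
theorem OptimalMachine.exists_KC_append_near {U : CondMachine} (hU : OptimalMachine U) :
    ∃ d : ℕ, ∀ (b : Bool) (x p q y y' : Str), y = strPair (p, q) →
      (y' = strPair (p ++ [b], q) ∨ y' = strPair (p, q ++ [b])) →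
      KC U x y ≤ KC U x y' + d ∧ KC U x y' ≤ KC U x y + d ∧
      KC U y x ≤ KC U y' x + d ∧ KC U y' x ≤ KC U y x + d := by
  have hfst : Primrec fun y => (strUnpair y).1 := Primrec.fst.comp primrec_strUnpair
  have hsnd : Primrec fun y => (strUnpair y).2 := Primrec.snd.comp primrec_strUnpair
  have hb : ∀ b : Bool, ∃ d : ℕ, ∀ (x p q y y' : Str), y = strPair (p, q) →
      (y' = strPair (p ++ [b], q) ∨ y' = strPair (p, q ++ [b])) →
      KC U x y ≤ KC U x y' + d ∧ KC U x y' ≤ KC U x y + d ∧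
      KC U y x ≤ KC U y' x + d ∧ KC U y' x ≤ KC U y x + d := by
    intro b
    obtain ⟨d₁, hd₁⟩ := hU.exists_KC_near
      (h := fun y => strPair ((strUnpair y).1 ++ [b], (strUnpair y).2))
      (h' := fun y => strPair ((strUnpair y).1.dropLast, (strUnpair y).2))
      (primrec_strPair.comp ((Primrec.list_append.comp hfst (Primrec.const [b])).pair hsnd)).to_comp
      (primrec_strPair.comp ((primrec_dropLast.comp hfst).pair hsnd)).to_comp
    obtain ⟨d₂, hd₂⟩ := hU.exists_KC_near
      (h := fun y => strPair ((strUnpair y).1, (strUnpair y).2 ++ [b]))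
      (h' := fun y => strPair ((strUnpair y).1, (strUnpair y).2.dropLast))
      (primrec_strPair.comp (hfst.pair (Primrec.list_append.comp hsnd (Primrec.const [b])))).to_comp
      (primrec_strPair.comp (hfst.pair (primrec_dropLast.comp hsnd))).to_comp
    refine ⟨d₁ + d₂, ?_⟩
    rintro x p q y y' rfl (rfl | rfl)
    · have := hd₁ x (strPair (p, q)) (strPair (p ++ [b], q)) (by simp) (by simp)
      omega
    · have := hd₂ x (strPair (p, q)) (strPair (p, q ++ [b])) (by simp) (by simp)
      omega
  choose d hd using hb
  refine ⟨d true + d false, fun b x p q y y' hy hy' => ?_⟩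
  have := hd b x p q y y' hy hy'
  cases b <;> omega

/-! ### Descriptions consisting of a short parameter and an index -/

/-- The natural number with a given binary expansion, least significant digit first. -/
def bitsValue (v : Str) : ℕ := v.foldr (fun b a => b.toNat + 2 * a) 0

theorem primrec_bitsValue : Primrec bitsValue := by
  have h : Primrec Bool.toNat := Primrec.dom_finite _
  have hstep : Primrec₂ fun (_ : Str) (q : Bool × ℕ) => q.1.toNat + 2 * q.2 :=
    Primrec.nat_add.comp (h.comp (Primrec.fst.comp Primrec.snd))
      (Primrec.nat_mul.comp (Primrec.const 2) (Primrec.snd.comp Primrec.snd))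
  exact Primrec.list_foldr Primrec.id (Primrec.const 0) hstep

theorem exists_bitsValue_eq (k : ℕ) : ∀ i < 2 ^ k, ∃ v : Str, v.length = k ∧ bitsValue v = i := by
  induction k with
  | zero => intro i hi; exact ⟨[], rfl, by simp_all [bitsValue]⟩
  | succ k ih =>
    intro i hi
    obtain ⟨v, hv, hi'⟩ := ih (i / 2) (by rw [pow_succ] at hi; omega)
    refine ⟨decide (i % 2 = 1) :: v, by simp [hv], ?_⟩
    change (decide (i % 2 = 1)).toNat + 2 * bitsValue v = i
    rw [hi']
    rcases Nat.mod_two_eq_zero_or_one i with h | h <;> simp [h] <;> omega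

/-- Decoding of strings of the form `1ᵏ 0 u v` with `|u| = k` into the numbers with binary
expansions `u` and `v`. -/
def decodeParam (w : Str) : ℕ × ℕ :=
  (bitsValue ((w.drop (w.idxOf false + 1)).take (w.idxOf false)),
    bitsValue ((w.drop (w.idxOf false + 1)).drop (w.idxOf false)))

theorem primrec_decodeParam : Primrec decodeParam := by
  have hk : Primrec fun w : Str => w.idxOf false :=
    Primrec.list_idxOf.comp (Primrec.const false) Primrec.id
  have hd : Primrec fun w : Str => w.drop (w.idxOf false + 1) :=
    Primrec.list_drop.comp (Primrec.succ.comp hk) Primrec.id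
  exact (primrec_bitsValue.comp (Primrec.list_take.comp hk hd)).pair
    (primrec_bitsValue.comp (Primrec.list_drop.comp hk hd))

theorem exists_decodeParam_eq (a i k : ℕ) (hi : i < 2 ^ k) :
    ∃ w : Str, w.length = 2 * a.size + 1 + k ∧ decodeParam w = (a, i) := by
  obtain ⟨u, hu, rfl⟩ := exists_bitsValue_eq a.size a (Nat.lt_size_self a)
  obtain ⟨v, hv, rfl⟩ := exists_bitsValue_eq k i hi
  generalize (bitsValue u).size = s at *
  have hidx : (List.replicate s true ++ false :: (u ++ v)).idxOf false = s := by
    rw [List.idxOf_append_of_notMem (by simp [List.mem_replicate])]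
    simp
  refine ⟨List.replicate s true ++ false :: (u ++ v), by simp; omega, ?_⟩
  have hdrop : (List.replicate s true ++ false :: (u ++ v)).drop (s + 1) = u ++ v := by
    rw [List.drop_append]; simp
  rw [decodeParam, hidx, hdrop]
  subst hu
  simp

/-- An object computed from the condition, a parameter `a` and an index below `2 ^ k` has
conditional complexity at most `k + O(log a)`. -/
theorem OptimalMachine.exists_KC_param_le {U : CondMachine} (hU : OptimalMachine U)
    {F : (ℕ × ℕ) × Str →. Str} (hF : Partrec F) :
    ∃ d : ℕ, ∀ (a i k : ℕ) (x y : Str), i < 2 ^ k → x ∈ F ((a, i), y) →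
      KC U x y ≤ 2 * a.size + k + d := by
  obtain ⟨d, hd⟩ := hU.exists_KC_le (V := fun a => F (decodeParam a.1, a.2))
    (hF.comp ((primrec_decodeParam.to_comp.comp Computable.fst).pair Computable.snd))
  refine ⟨d + 1, fun a i k x y hi hx => ?_⟩
  obtain ⟨w, hw, hdec⟩ := exists_decodeParam_eq a i k hi
  have := hd w x y (by rw [hdec]; exact hx)
  omega

/-! ### Step-bounded evaluation and enumeration -/

theorem Partrec.exists_primrec_stages {α β : Type*} [Primcodable α] [Primcodable β]
    {f : α →. β} (hf : Partrec f) :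
    ∃ run : ℕ → α → Option β, Primrec₂ run ∧
      (∀ s t a b, s ≤ t → run s a = some b → run t a = some b) ∧
      ∀ a b, b ∈ f a ↔ ∃ t, run t a = some b := by
  obtain ⟨c, hc⟩ := Nat.Partrec.Code.exists_code.1 hf
  refine ⟨fun t a => (c.evaln t (Encodable.encode a)).bind Encodable.decode, ?_, ?_, ?_⟩
  · exact Primrec.option_bind (Nat.Partrec.Code.primrec_evaln.comp
      ((Primrec.fst.pair (Primrec.const c)).pair (Primrec.encode.comp Primrec.snd)))
      (Primrec.decode.comp Primrec.snd).to₂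
  · intro s t a b hst h
    obtain ⟨v, hv, hb⟩ := Option.bind_eq_some_iff.1 h
    exact Option.bind_eq_some_iff.2 ⟨v, Nat.Partrec.Code.evaln_mono hst hv, hb⟩
  · intro a b
    have heval : c.eval (Encodable.encode a) = (f a).map Encodable.encode := by
      rw [hc]; simp
    constructor
    · intro h
      have : Encodable.encode b ∈ c.eval (Encodable.encode a) := by
        rw [heval]; exact Part.mem_map _ h
      obtain ⟨t, ht⟩ := Nat.Partrec.Code.evaln_complete.1 this
      exact ⟨t, Option.bind_eq_some_iff.2 ⟨_, ht, Encodable.encodek b⟩⟩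
    · rintro ⟨t, ht⟩
      obtain ⟨v, hv, hb⟩ := Option.bind_eq_some_iff.1 ht
      have := Nat.Partrec.Code.evaln_sound hv
      rw [heval] at this
      obtain ⟨b', hb', rfl⟩ := (Part.mem_map_iff _).1 this
      rw [Encodable.encodek, Option.some_inj] at hb
      exact hb ▸ hb'

/-- The list, without repetitions, of the values produced by `ev` before stage `s`. -/
def enumList (ev : ℕ → Option Str) : ℕ → List Str
  | 0 => []
  | s + 1 => enumList ev s ++ ((ev s).toList.filter fun x => x ∉ enumList ev s)

theorem primrec_enumList {ev : ℕ → ℕ → Option Str} (hev : Primrec₂ ev) :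
    Primrec₂ fun a s => enumList (ev a) s := by
  have hmem : PrimrecRel fun (x : Str) (l : List Str) => x ∈ l :=
    (PrimrecRel.exists_mem_list (Primrec.eq (α := Str))).swap.of_eq (by simp)
  have hfilter : Primrec₂ fun (m l : List Str) => m.filter fun x => x ∉ l :=
    PrimrecRel.listFilter hmem.not
  have hstep : Primrec₂ fun (a : ℕ) (q : ℕ × List Str) =>
      q.2 ++ ((ev a q.1).toList.filter fun x => x ∉ q.2) :=
    Primrec.list_append.comp (Primrec.snd.comp Primrec.snd)
      (hfilter.comp (Primrec.optionToList.comp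
        (hev.comp Primrec.fst (Primrec.fst.comp Primrec.snd))) (Primrec.snd.comp Primrec.snd))
  refine (Primrec.nat_rec (Primrec.const []) hstep).of_eq ?_
  intro a s
  induction s with
  | zero => rfl
  | succ s ih => simp only [enumList]; rw [← ih]

theorem nodup_enumList (ev : ℕ → Option Str) (s : ℕ) : (enumList ev s).Nodup := by
  induction s with
  | zero => exact List.nodup_nil
  | succ s ih =>
    refine List.Nodup.append ih (List.Nodup.filter _ ?_) ?_
    · cases ev s <;> simp
    · intro x hx hx'
      simp [hx] at hx'

theorem mem_enumList {ev : ℕ → Option Str} {x : Str} {s : ℕ} :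
    x ∈ enumList ev s ↔ ∃ t < s, ev t = some x := by
  induction s with
  | zero => simp [enumList]
  | succ s ih =>
    simp only [enumList, List.mem_append, List.mem_filter, Option.mem_toList,
      decide_eq_true_eq, Nat.lt_succ_iff_lt_or_eq, or_and_right, exists_or, ih, exists_eq_left]
    by_cases h : ∃ t < s, ev t = some x <;> simp [h]

theorem enumList_isPrefix_of_le (ev : ℕ → Option Str) {s t : ℕ} (h : s ≤ t) :
    enumList ev s <+: enumList ev t := by
  induction h with
  | refl => exact List.prefix_refl _
  | step _ ih => exact ih.trans (List.prefix_append _ _)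

/-- A uniformly enumerable family of sets can be enumerated without repetitions, so elements of
a set with at most `K` elements are computed from an index below `K`. -/
theorem exists_partrec_index {ev : ℕ → ℕ → Option Str} (hev : Primrec₂ ev) :
    ∃ F : ℕ × ℕ →. Str, Partrec F ∧ ∀ (a K : ℕ) (x : Str),
      (∀ S : Finset Str, (∀ z ∈ S, ∃ s, ev a s = some z) → S.card ≤ K) →
      (∃ s, ev a s = some x) → ∃ i < K, x ∈ F (a, i) := by
  have hcomp : Primrec₂ fun (q : ℕ × ℕ) (s : ℕ) => (enumList (ev q.1) s)[q.2]? :=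
    Primrec.list_getElem?.comp
      ((primrec_enumList hev).comp (Primrec.fst.comp Primrec.fst) Primrec.snd)
      (Primrec.snd.comp Primrec.fst)
  refine ⟨_, Partrec.rfindOpt hcomp.to_comp, fun a K x hK ⟨s, hs⟩ => ?_⟩
  have hx : x ∈ enumList (ev a) (s + 1) := mem_enumList.2 ⟨s, s.lt_succ_self, hs⟩
  obtain ⟨i, hi, rfl⟩ := List.getElem_of_mem hx
  refine ⟨i, hi.trans_le ?_, ?_⟩
  · rw [← List.toFinset_card_of_nodup (nodup_enumList _ _)]
    refine hK _ fun z hz => ?_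
    obtain ⟨t, -, ht⟩ := mem_enumList.1 (List.mem_toFinset.1 hz)
    exact ⟨t, ht⟩
  · rw [Nat.rfindOpt_mono]
    · exact ⟨s + 1, List.getElem?_eq_getElem hi⟩
    · intro b m n hmn hb
      obtain ⟨r, hr⟩ := enumList_isPrefix_of_le (ev a) hmn
      obtain ⟨hlt, -⟩ := List.getElem?_eq_some_iff.1 hb
      change (enumList (ev a) n)[i]? = some b
      rw [← hr, List.getElem?_append_left hlt]
      exact hb

/-! ### Lists of strings of bounded length -/

/-- All strings of length `k`. -/
def strsOfLength : ℕ → List Str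
  | 0 => [[]]
  | k + 1 => (strsOfLength k).flatMap fun s => [false :: s, true :: s]

/-- All strings of length less than `k`. -/
def strsBelow (k : ℕ) : List Str := (List.range k).flatMap strsOfLength

theorem primrec_strsOfLength : Primrec strsOfLength := by
  have hstep : Primrec₂ fun (_ : ℕ) (l : List Str) =>
      l.flatMap fun s => [false :: s, true :: s] := by
    refine Primrec.list_flatMap Primrec.snd (Primrec₂.mk ?_)
    exact Primrec.list_cons.comp (Primrec.list_cons.comp (Primrec.const false) Primrec.snd)
      (Primrec.list_cons.comp (Primrec.list_cons.comp (Primrec.const true) Primrec.snd)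
        (Primrec.const []))
  refine (Primrec.nat_rec₁ [[]] hstep).of_eq fun k => ?_
  induction k with
  | zero => rfl
  | succ k ih => simp only [strsOfLength]; rw [← ih]

theorem primrec_strsBelow : Primrec strsBelow :=
  Primrec.list_flatMap Primrec.list_range (primrec_strsOfLength.comp Primrec.snd).to₂

theorem mem_strsOfLength {k : ℕ} : ∀ {s : Str}, s ∈ strsOfLength k ↔ s.length = k := by
  induction k with
  | zero => simp [strsOfLength]
  | succ k ih =>
    intro s
    rcases s with _ | ⟨_ | _, s⟩ <;> simp [strsOfLength, ih]

theorem mem_strsBelow {k : ℕ} {s : Str} : s ∈ strsBelow k ↔ s.length < k := by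
  simp [strsBelow, mem_strsOfLength]

theorem length_strsOfLength (k : ℕ) : (strsOfLength k).length = 2 ^ k := by
  induction k with
  | zero => rfl
  | succ k ih => simp [strsOfLength, ih, pow_succ, mul_comm]

theorem length_strsBelow (k : ℕ) : (strsBelow k).length + 1 = 2 ^ k := by
  induction k with
  | zero => rfl
  | succ k ih =>
    have : strsBelow (k + 1) = strsBelow k ++ strsOfLength k := by
      simp [strsBelow, List.range_succ]
    rw [this, List.length_append, length_strsOfLength, pow_succ]
    omega

theorem nodup_strsOfLength (k : ℕ) : (strsOfLength k).Nodup := by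
  induction k with
  | zero => simp [strsOfLength]
  | succ k ih =>
    refine List.nodup_flatMap.2 ⟨by simp, ih.imp fun hne => ?_⟩
    simp [hne.symm]

/-! ### A string independent of `x` -/

theorem card_bad_objects_le (U : CondMachine) (n L : ℕ) (g : ℕ → Str) (S : Finset Str)
    (hS : ∀ x ∈ S, ∃ p : Str, p.length < n ∧ ∃ l < L, x ∈ U.1 (p, g l)) :
    S.card ≤ (strsBelow n).length * L := by
  classical
  have hsub : S ⊆ ((strsBelow n).toFinset ×ˢ Finset.range L).image
      fun q => (U.1 (q.1, g q.2)).toOption.getD [] := by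
    intro x hx
    obtain ⟨p, hp, l, hl, hmem⟩ := hS x hx
    refine Finset.mem_image.2 ⟨(p, l), ?_, ?_⟩
    · simp [mem_strsBelow, hp, hl]
    · have : x ∈ (U.1 (p, g l)).toOption := Part.mem_toOption.2 hmem
      rw [Option.mem_def] at this
      simp [this]
  refine (Finset.card_le_card hsub).trans (Finset.card_image_le.trans ?_)
  rw [Finset.card_product, Finset.card_range]
  exact Nat.mul_le_mul_right _ (List.toFinset_card_le _)

/-- The strings `r` of length `L + 1` of which some prefix helps to describe `x` by a program of
length less than `n`. -/
def BadCondition (U : CondMachine) (n L : ℕ) (x r : Str) : Prop :=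
  ∃ p : Str, p.length < n ∧ ∃ l < L + 2, x ∈ U.1 (p, strPair ([], r.take l))

open Classical in
theorem card_objects_with_many_bad_le (U : CondMachine) (n L : ℕ) (S : Finset Str)
    (hS : ∀ x ∈ S, 2 ^ L ≤
      ((strsOfLength (L + 1)).toFinset.filter (BadCondition U n L x)).card) :
    S.card ≤ 2 ^ (n + 1) * (L + 2) := by
  have h := Finset.card_mul_le_card_mul (s := S) (t := (strsOfLength (L + 1)).toFinset)
    (BadCondition U n L) (m := 2 ^ L) (n := 2 ^ n * (L + 2)) hS
    (fun r _ => (card_bad_objects_le U n (L + 2) (fun l => strPair ([], r.take l)) _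
      fun x hx => (Finset.mem_filter.1 hx).2).trans
        (Nat.mul_le_mul_right _ ((Nat.le_succ _).trans_eq (length_strsBelow n))))
  rw [List.toFinset_card_of_nodup (nodup_strsOfLength _), length_strsOfLength] at h
  refine Nat.le_of_mul_le_mul_right (h.trans_eq ?_) (Nat.two_pow_pos L)
  ring

open Classical in
/-- The set of strings `x` for which at least half of the strings of length `L + 1` are bad is
enumerable uniformly in `n` and `L`. -/
theorem exists_primrec_enum_many_bad (U : CondMachine) :
    ∃ ev : ℕ → ℕ → Option Str, Primrec₂ ev ∧ ∀ (n L : ℕ) (x : Str),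
      (∃ s, ev (Nat.pair n L) s = some x) ↔
        2 ^ L ≤ ((strsOfLength (L + 1)).toFinset.filter (BadCondition U n L x)).card := by
  obtain ⟨run, hrun, hmono, hspec⟩ := U.2.exists_primrec_stages
  let R₀ (l : ℕ) (q : Str × Str × (ℕ × ℕ) × Str × ℕ) : Prop :=
    run q.2.2.2.2 (q.1, strPair ([], q.2.1.take l)) = some q.2.2.2.1
  let R₁ (p : Str) (q : Str × (ℕ × ℕ) × Str × ℕ) : Prop := ∃ l < q.2.1.2 + 2, R₀ l (p, q)
  let R₂ (r : Str) (q : (ℕ × ℕ) × Str × ℕ) : Prop := ∃ p ∈ strsBelow q.1.1, R₁ p (r, q)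
  have hR₀ : PrimrecRel R₀ := by
    have hq : Primrec fun z : ℕ × Str × Str × (ℕ × ℕ) × Str × ℕ => z.2.2.2.2 :=
      Primrec.snd.comp (Primrec.snd.comp (Primrec.snd.comp Primrec.snd))
    have hr : Primrec fun z : ℕ × Str × Str × (ℕ × ℕ) × Str × ℕ => z.2.2.1 :=
      Primrec.fst.comp (Primrec.snd.comp Primrec.snd)
    exact Primrec.eq.comp
      (hrun.comp (Primrec.snd.comp hq) ((Primrec.fst.comp Primrec.snd).pair
        (primrec_strPair.comp ((Primrec.const []).pair (Primrec.list_take.comp Primrec.fst hr)))))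
      (Primrec.option_some.comp (Primrec.fst.comp hq))
  have hlt : PrimrecRel fun N q => ∃ l < N, R₀ l q :=
    (hR₀.exists_mem_list.comp (Primrec.list_range.comp Primrec.fst) Primrec.snd).of_eq (by simp)
  have hR₁ : PrimrecRel R₁ :=
    hlt.comp (f := fun z : Str × Str × (ℕ × ℕ) × Str × ℕ => z.2.2.1.2 + 2)
      (Primrec.nat_add.comp (Primrec.snd.comp (Primrec.fst.comp
        (Primrec.snd.comp Primrec.snd))) (Primrec.const 2)) Primrec.id
  have hR₂ : PrimrecRel R₂ :=
    hR₁.exists_mem_list.comp (f := fun z : Str × (ℕ × ℕ) × Str × ℕ => strsBelow z.2.1.1)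
      (primrec_strsBelow.comp (Primrec.fst.comp (Primrec.fst.comp Primrec.snd))) Primrec.id
  let count (q : (ℕ × ℕ) × Str × ℕ) : ℕ :=
    ((strsOfLength (q.1.2 + 1)).filter fun r => R₂ r q).length
  have hcount : Primrec count :=
    Primrec.list_length.comp (hR₂.listFilter.comp
      (primrec_strsOfLength.comp (Primrec.succ.comp (Primrec.snd.comp Primrec.fst))) Primrec.id)
  have hpow : Primrec fun L : ℕ => 2 ^ L :=
    (Primrec.list_length.comp primrec_strsOfLength).of_eq length_strsOfLength
  let test (q : (ℕ × ℕ) × Str × ℕ) : Option Str :=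
    if 2 ^ q.1.2 ≤ count q then some q.2.1 else none
  have htest : Primrec test :=
    Primrec.ite (Primrec.nat_le.comp (hpow.comp (Primrec.snd.comp Primrec.fst)) hcount)
      (Primrec.option_some.comp (Primrec.fst.comp Primrec.snd)) (Primrec.const none)
  have hcard : ∀ q, count q =
      ((strsOfLength (q.1.2 + 1)).toFinset.filter fun r => R₂ r q).card := by
    intro q
    simp only [count]
    rw [← List.toFinset_card_of_nodup ((nodup_strsOfLength _).filter _), List.toFinset_filter]
    simp
  refine ⟨fun a s => (Encodable.decode (α := Str × ℕ) s).bind fun z => test (a.unpair, z),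
    ?_, fun n L x => ?_⟩
  · exact Primrec.option_bind (Primrec.decode.comp Primrec.snd)
      (htest.comp ((Primrec.unpair.comp (Primrec.fst.comp Primrec.fst)).pair Primrec.snd)).to₂
  · simp only [Nat.unpair_pair]
    constructor
    · rintro ⟨s, hs⟩
      obtain ⟨⟨x', t⟩, -, hz⟩ := Option.bind_eq_some_iff.1 hs
      simp only [test, hcard] at hz
      split_ifs at hz with hle
      obtain rfl : x' = x := by simpa using hz
      refine hle.trans (Finset.card_le_card (Finset.monotone_filter_right _ ?_))
      rintro r - ⟨p, hp, l, hl, h⟩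
      exact ⟨p, mem_strsBelow.1 hp, l, hl, (hspec _ _).2 ⟨t, h⟩⟩
    · intro hle
      have hstage : ∀ r, ∃ t, BadCondition U n L x r → R₂ r ((n, L), x, t) := by
        intro r
        by_cases hr : BadCondition U n L x r
        · obtain ⟨p, hp, l, hl, h⟩ := hr
          obtain ⟨t, ht⟩ := (hspec _ _).1 h
          exact ⟨t, fun _ => ⟨p, mem_strsBelow.2 hp, l, hl, ht⟩⟩
        · exact ⟨0, fun h => absurd h hr⟩
      choose t ht using hstage
      let T := (strsOfLength (L + 1)).toFinset.sup t
      refine ⟨Encodable.encode (x, T), ?_⟩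
      simp only [Encodable.encodek, Option.bind_some, test, hcard]
      refine if_pos (hle.trans (Finset.card_le_card fun r hr => ?_))
      obtain ⟨hmem, hbad⟩ := Finset.mem_filter.1 hr
      refine Finset.mem_filter.2 ⟨hmem, ?_⟩
      obtain ⟨p, hp, l, hl, h⟩ := ht r hbad
      exact ⟨p, hp, l, hl, hmono _ _ _ _ (Finset.le_sup (f := t) hmem) h⟩

/-- If `x` is sufficiently complex, there is a string `r` which is random given `x` and no prefix
of which helps to describe `x`. -/
theorem OptimalMachine.exists_independent {U : CondMachine} (hU : OptimalMachine U) :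
    ∃ d : ℕ, ∀ (n L : ℕ) (x : Str),
      2 * (Nat.pair n L).size + (n + 1 + (L + 2).size) + d < KC U x [] →
      ∃ r : Str, r.length = L + 1 ∧ L ≤ KC U r x ∧
        ∀ l ≤ L + 1, n ≤ KC U x (strPair ([], r.take l)) := by
  classical
  obtain ⟨ev, hev, hspec⟩ := exists_primrec_enum_many_bad U
  obtain ⟨F, hF, hindex⟩ := exists_partrec_index hev
  obtain ⟨d, hd⟩ := hU.exists_KC_param_le (F := fun q => F q.1) (hF.comp Computable.fst)
  refine ⟨d, fun n L x hx => ?_⟩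
  set T := (strsOfLength (L + 1)).toFinset with hT
  have hfew : (T.filter (BadCondition U n L x)).card < 2 ^ L := by
    by_contra! hmany
    obtain ⟨i, hi, hmem⟩ := hindex (Nat.pair n L) (2 ^ (n + 1) * (L + 2)) x
      (fun S hS => card_objects_with_many_bad_le U n L S fun z hz => (hspec n L z).1 (hS z hz))
      ((hspec n L x).2 hmany)
    have hi' : i < 2 ^ (n + 1 + (L + 2).size) := by
      rw [pow_add]
      exact hi.trans_le (Nat.mul_le_mul_left _ (Nat.lt_size_self _).le)
    exact absurd (hd _ _ _ x [] hi' hmem) (by omega)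
  have hsimple : (T.filter fun r => KC U r x < L).card < 2 ^ L := by
    have hsub := card_bad_objects_le U L 1 (fun _ => x) (T.filter fun r => KC U r x < L) ?_
    · have := length_strsBelow L
      omega
    · intro r hr
      obtain ⟨p, hp, hlen⟩ := exists_program hU r x
      exact ⟨p, hlen ▸ (Finset.mem_filter.1 hr).2, 0, one_pos, hp⟩
  have hcardT : T.card = 2 ^ L + 2 ^ L := by
    rw [hT, List.toFinset_card_of_nodup (nodup_strsOfLength _), length_strsOfLength]
    ring
  obtain ⟨r, hrT, hr⟩ : ∃ r ∈ T,
      r ∉ T.filter (BadCondition U n L x) ∪ T.filter fun r => KC U r x < L := by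
    refine Finset.exists_mem_notMem_of_card_lt_card ?_
    have := Finset.card_union_le (T.filter (BadCondition U n L x))
      (T.filter fun r => KC U r x < L)
    omega
  simp only [Finset.mem_union, Finset.mem_filter, hrT, true_and, not_or, not_lt] at hr
  refine ⟨r, mem_strsOfLength.1 (List.mem_toFinset.1 hrT), hr.2, fun l hl => ?_⟩
  by_contra! hlt
  obtain ⟨p, hp, hlen⟩ := exists_program hU x (strPair ([], r.take l))
  exact hr.1 ⟨p, hlen ▸ hlt, l, by omega, hp⟩

/-- Every string `x` has a shortest program all prefixes of which are simple given `x`. -/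
theorem OptimalMachine.exists_simple_program {U : CondMachine} (hU : OptimalMachine U) :
    ∃ d : ℕ, ∀ x : Str, ∃ p : Str, p.length = KC U x [] ∧ x ∈ U.1 (p, []) ∧
      ∀ k, KC U (strPair (p.take k, [])) x ≤ 2 * (Nat.pair (KC U x []) k).size + d := by
  obtain ⟨run, hrun, -, hspec⟩ := U.2.exists_primrec_stages
  let test (q : ℕ × Str) (z : Str × ℕ) : Option Str :=
    if z.1.length = q.1 ∧ run z.2 (z.1, []) = some q.2 then some z.1 else none
  have htest : Primrec₂ test := by
    refine Primrec.ite (PrimrecPred.and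
      (Primrec.eq.comp (Primrec.list_length.comp (Primrec.fst.comp Primrec.snd))
        (Primrec.fst.comp Primrec.fst))
      (Primrec.eq.comp (hrun.comp (Primrec.snd.comp Primrec.snd)
        ((Primrec.fst.comp Primrec.snd).pair (Primrec.const [])))
        (Primrec.option_some.comp (Primrec.snd.comp Primrec.fst))))
      (Primrec.option_some.comp (Primrec.fst.comp Primrec.snd)) (Primrec.const none)
  let stage (q : ℕ × Str) (s : ℕ) : Option Str :=
    (Encodable.decode (α := Str × ℕ) s).bind (test q)
  have hstage : Primrec₂ stage :=
    Primrec.option_bind (Primrec.decode.comp Primrec.snd)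
      (htest.comp (Primrec.fst.comp Primrec.fst) Primrec.snd).to₂
  have hsearch : Partrec fun q => Nat.rfindOpt (stage q) := Partrec.rfindOpt hstage.to_comp
  have hF : Partrec fun q : (ℕ × ℕ) × Str =>
      (Nat.rfindOpt (stage (q.1.1.unpair.1, q.2))).map
        fun p => strPair (p.take q.1.1.unpair.2, []) := by
    have hunpair : Primrec fun q : (ℕ × ℕ) × Str => q.1.1.unpair :=
      Primrec.unpair.comp (Primrec.fst.comp Primrec.fst)
    refine Partrec.map (hsearch.comp
      ((Primrec.fst.comp hunpair).pair Primrec.snd).to_comp) (Primrec.to_comp ?_)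
    exact primrec_strPair.comp ((Primrec.list_take.comp
      (Primrec.snd.comp (hunpair.comp Primrec.fst)) Primrec.snd).pair (Primrec.const []))
  obtain ⟨d, hd⟩ := hU.exists_KC_param_le hF
  refine ⟨d, fun x => ?_⟩
  obtain ⟨p₀, hp₀, hlen₀⟩ := exists_program hU x []
  obtain ⟨t₀, ht₀⟩ := (hspec _ _).1 hp₀
  have hdom : (Nat.rfindOpt (stage (KC U x [], x))).Dom :=
    Nat.rfindOpt_dom.2 ⟨Encodable.encode (p₀, t₀), p₀, by simp [stage, test, hlen₀, ht₀]⟩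
  obtain ⟨p, hp⟩ := Part.dom_iff_mem.1 hdom
  obtain ⟨s, hs⟩ := Nat.rfindOpt_spec hp
  obtain ⟨⟨p', t⟩, -, hz⟩ := Option.bind_eq_some_iff.1 hs
  simp only [test] at hz
  split_ifs at hz with hcond
  obtain rfl : p' = p := by simpa using hz
  refine ⟨p', hcond.1, (hspec _ _).2 ⟨t, hcond.2⟩, fun k => ?_⟩
  refine hd (Nat.pair (KC U x []) k) 0 0 _ x Nat.one_pos ?_
  simpa using Part.mem_map (fun p : Str => strPair (p.take k, [])) hp

/-! ### Logarithmic bounds -/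

theorem exists_eval_lt_two_pow (Q : Polynomial ℕ) :
    ∃ e : ℕ, ∀ n : ℕ, Q.eval n < 2 ^ (e * log2 n) := by
  have hlog : ∀ n, 1 ≤ log2 n := fun n => Nat.log_pos one_lt_two (by omega)
  induction Q using Polynomial.induction_on' with
  | add p q hp hq =>
    obtain ⟨e₁, h₁⟩ := hp
    obtain ⟨e₂, h₂⟩ := hq
    refine ⟨e₁ + e₂ + 1, fun n => ?_⟩
    have h₁ : p.eval n < 2 ^ ((e₁ + e₂) * log2 n) :=
      (h₁ n).trans_le (Nat.pow_le_pow_right two_pos (Nat.mul_le_mul_right _ (by omega)))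
    have h₂ : q.eval n < 2 ^ ((e₁ + e₂) * log2 n) :=
      (h₂ n).trans_le (Nat.pow_le_pow_right two_pos (Nat.mul_le_mul_right _ (by omega)))
    have h₃ : 2 ^ ((e₁ + e₂) * log2 n + 1) ≤ 2 ^ ((e₁ + e₂ + 1) * log2 n) := by
      refine Nat.pow_le_pow_right two_pos ?_
      have := hlog n
      rw [add_mul _ 1]
      omega
    rw [pow_succ] at h₃
    rw [Polynomial.eval_add]
    omega
  | monomial k a =>
    refine ⟨a + 2 * k, fun n => ?_⟩
    have hn : n ≤ 2 ^ (2 * log2 n) := by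
      have h := Nat.lt_pow_succ_log_self one_lt_two (n + 2)
      have h' : 2 ^ (Nat.log 2 (n + 2)).succ ≤ 2 ^ (2 * log2 n) :=
        Nat.pow_le_pow_right two_pos (by have := hlog n; unfold log2 at *; omega)
      omega
    have ha : a < 2 ^ (a * log2 n) :=
      Nat.lt_two_pow_self.trans_le (Nat.pow_le_pow_right two_pos (Nat.le_mul_of_pos_right _ (hlog n)))
    rw [Polynomial.eval_monomial, add_mul, pow_add]
    refine Nat.mul_lt_mul_of_lt_of_le ha ?_ (by positivity)
    calc n ^ k ≤ (2 ^ (2 * log2 n)) ^ k := Nat.pow_le_pow_left hn k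
      _ = 2 ^ (2 * k * log2 n) := by rw [← pow_mul]; congr 1; ring

theorem size_pair_le {u v s : ℕ} (hu : u < 2 ^ s) (hv : v < 2 ^ s) :
    (Nat.pair u v).size ≤ 2 * s := by
  refine Nat.size_le.2 ((Nat.pair_lt_max_add_one_sq u v).trans_le ?_)
  rw [mul_comm, pow_mul]
  exact Nat.pow_le_pow_left (max_lt hu hv) 2

/-! ### The main theorem -/

/-- A two-parameter family of strings that starts from a program `p` and a string `r`. -/
def gridStr (p r : Str) (k l : ℕ) : Str := strPair (p.take k, r.take l)

/-- Complexities of neighbouring strings of the grid differ by at most a constant. -/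
theorem OptimalMachine.exists_KC_grid_near {U : CondMachine} (hU : OptimalMachine U) :
    ∃ d : ℕ, ∀ (x p r : Str) (k l i j : ℕ), k < p.length → l < r.length → i ≤ 1 → j ≤ 1 →
      KC U x (gridStr p r k l) ≤ KC U x (gridStr p r (k + i) (l + j)) + d ∧
      KC U x (gridStr p r (k + i) (l + j)) ≤ KC U x (gridStr p r k l) + d ∧
      KC U (gridStr p r k l) x ≤ KC U (gridStr p r (k + i) (l + j)) x + d ∧
      KC U (gridStr p r (k + i) (l + j)) x ≤ KC U (gridStr p r k l) x + d := by
  obtain ⟨d, hd⟩ := hU.exists_KC_append_near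
  refine ⟨2 * d, fun x p r k l i j hk hl hi hj => ?_⟩
  have hright := fun l' => hd p[k] x (p.take k) (r.take l') (gridStr p r k l')
    (gridStr p r (k + 1) l') rfl (Or.inl (by simp [gridStr]))
  have hup := hd r[l] x (p.take k) (r.take l) (gridStr p r k l)
    (gridStr p r k (l + 1)) rfl (Or.inr (by simp [gridStr]))
  have h₀ := hright l
  have h₁ := hright (l + 1)
  interval_cases i <;> interval_cases j <;> try simp only [Nat.add_zero]
  all_goals omega

/-- Theorem 1: for every polynomial `P` there is a constant `c` such that for
every string `x` and all positive `m, n` with `n + c·log n ≤ C(x) ≤ P(n)` and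
`c·log n ≤ m ≤ P(n)`, there is a string `y` with `C(x|y) = n + O(1)` and
`C(y|x) = m + O(1)`. -/
theorem vyugin_extension (U : CondMachine) (hU : OptimalMachine U) (P : Polynomial ℕ) :
    ∃ c : ℕ, ∀ (x : Str) (m n : ℕ), 0 < m → 0 < n →
      n + c * log2 n ≤ KC U x [] → KC U x [] ≤ P.eval n →
      c * log2 n ≤ m → m ≤ P.eval n →
      ∃ y : Str, |(KC U x y : ℤ) - (n : ℤ)| ≤ (c : ℤ) ∧
        |(KC U y x : ℤ) - (m : ℤ)| ≤ (c : ℤ) := by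
  obtain ⟨D, hgrid⟩ := hU.exists_KC_grid_near
  obtain ⟨d_ind, hind⟩ := hU.exists_independent
  obtain ⟨d_prog, hprog⟩ := hU.exists_simple_program
  obtain ⟨d_snd, hsnd⟩ := hU.exists_KC_comp_le (h := fun y => (strUnpair y).2)
    (Primrec.snd.comp primrec_strUnpair).to_comp
  obtain ⟨d_fst, hfst⟩ := hU.exists_KC_le (V := fun a => U.1 ((strUnpair a.2).1, []))
    (U.2.comp ((Primrec.fst.comp (primrec_strUnpair.comp Primrec.snd)).pair
      (Primrec.const [])).to_comp)
  obtain ⟨e, he⟩ := exists_eval_lt_two_pow (P + Polynomial.C (d_fst + d_snd + 3))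
  refine ⟨5 * e + d_ind + d_prog + d_fst + 4 + 2 * D, ?_⟩
  intro x m n _ _ hnx hxP hm hmP
  set c := 5 * e + d_ind + d_prog + d_fst + 4 + 2 * D with hc
  have hlog : 1 ≤ log2 n := Nat.log_pos one_lt_two (by omega)
  have hclog : 5 * (e * log2 n) + (d_ind + d_prog + d_fst + 4) ≤ c * log2 n := by
    rw [hc]
    nlinarith [Nat.zero_le (D * log2 n)]
  have hB := he n
  rw [Polynomial.eval_add, Polynomial.eval_C] at hB
  generalize e * log2 n = s at *
  obtain ⟨p, hplen, hpx, hpsimple⟩ := hprog x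
  have hpair₁ : (Nat.pair (n + d_fst + 1) (m + d_snd)).size ≤ 2 * s :=
    size_pair_le (by omega) (by omega)
  have hsize : (m + d_snd + 2).size ≤ s := Nat.size_le.2 (by omega)
  obtain ⟨r, hrlen, hrx, hrind⟩ := hind (n + d_fst + 1) (m + d_snd) x (by omega)
  obtain ⟨k, hk, l, hl, hA, hA', hB, hB'⟩ := exists_mixed_square
    (fun k l => decide (n + d_fst < KC U x (gridStr p r k l)))
    (fun k l => decide (m ≤ KC U (gridStr p r k l) x)) (KC U x []) (m + d_snd + 1)
    (fun l hl => by
      have : _ ≤ KC U x (gridStr p r 0 l) := hrind l hl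
      simp only [decide_eq_true_eq]
      omega)
    (fun l hl => by
      have := hfst [] x (gridStr p r (KC U x []) l) (by simpa [gridStr, ← hplen] using hpx)
      simp only [List.length_nil] at this
      simp only [decide_eq_false_iff_not]
      omega)
    (fun k hk => by
      have h₁ : KC U (gridStr p r k 0) x ≤ _ := hpsimple k
      have h₂ : (Nat.pair (KC U x []) k).size ≤ 2 * s := size_pair_le (by omega) (by omega)
      simp only [decide_eq_false_iff_not]
      omega)
    (fun k hk => by
      have := (hsnd x (gridStr p r k (m + d_snd + 1))).2
      simp only [gridStr, strUnpair_strPair, ← hrlen, List.take_length] at this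
      simp only [gridStr, ← hrlen, List.take_length, decide_eq_true_eq]
      omega)
  have hnear := fun i j hi hj => hgrid x p r k l i j (by omega) (by omega) hi hj
  have h₀₁ := hnear 0 1 (by omega) le_rfl
  have h₁₀ := hnear 1 0 le_rfl (by omega)
  have h₁₁ := hnear 1 1 le_rfl le_rfl
  simp only [Nat.add_zero] at h₀₁ h₁₀
  simp only [Bool.or_eq_true, Bool.and_eq_true, decide_eq_true_eq] at hA hA' hB hB'
  refine ⟨gridStr p r k l, ?_, ?_⟩ <;> rw [abs_le] <;> constructor <;> omega
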